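/- (Fourier transform of the high-peak-tent density.) Let p(t) = (2/π) ln|coth(πt/2)| for t ∈ ℝ \ {0}. Then for every ν ∈ ℝ with ν ≠ 0, ∫_ℝ p(t) e^{−iνt} dt = tanh(ν/2)/(ν/2), and ∫_ℝ p(t) dt = 1. -/

import Mathlib

open MeasureTheory

noncomputable section

/-- The high-peak-tent density `p(t) = (2/π) ln |coth (π t / 2)|`. -/
def hptDensity (t : ℝ) : ℝ :=
  (2 / Real.pi) * Real.log |Real.cosh (Real.pi * t / 2) / Real.sinh (Real.pi * t / 2)|

lemma hpt_exp_int (a ν : ℝ) (ha : 0 < a) :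
    Integrable (fun t : ℝ => (Real.exp (-a * |t|) : ℂ) * Complex.exp (-(Complex.I * ν * t))) ∧
    (∫ t : ℝ, (Real.exp (-a * |t|) : ℂ) * Complex.exp (-(Complex.I * ν * t))) =
      ((2 * a / (a ^ 2 + ν ^ 2) : ℝ) : ℂ) := by
  have e1 : Set.EqOn (fun t : ℝ => Complex.exp ((a - Complex.I * ν : ℂ) * t))
      (fun t : ℝ => (Real.exp (-a * |t|) : ℂ) * Complex.exp (-(Complex.I * ν * t))) (Set.Iic 0) := by
    intro t ht
    simp only [Set.mem_Iic] at ht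
    simp only [abs_of_nonpos ht, Complex.ofReal_exp, ← Complex.exp_add]
    congr 1; push_cast; ring
  have e2 : Set.EqOn (fun t : ℝ => Complex.exp ((-a - Complex.I * ν : ℂ) * t))
      (fun t : ℝ => (Real.exp (-a * |t|) : ℂ) * Complex.exp (-(Complex.I * ν * t))) (Set.Ioi 0) := by
    intro t ht
    simp only [Set.mem_Ioi] at ht
    simp only [abs_of_pos ht, Complex.ofReal_exp, ← Complex.exp_add]
    congr 1; push_cast; ring
  have r1 : 0 < (a - Complex.I * ν : ℂ).re := by simpa using ha
  have r2 : (-a - Complex.I * ν : ℂ).re < 0 := by simpa using ha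
  have i1 := (integrableOn_exp_mul_complex_Iic r1 0).congr_fun e1 measurableSet_Iic
  have i2 := (integrableOn_exp_mul_complex_Ioi r2 0).congr_fun e2 measurableSet_Ioi
  refine ⟨by
    rw [← integrableOn_univ, ← Set.Iic_union_Ioi (a := (0:ℝ))]
    exact i1.union i2, ?_⟩
  rw [← intervalIntegral.integral_Iic_add_Ioi i1 i2, ← setIntegral_congr_fun measurableSet_Iic e1,
    ← setIntegral_congr_fun measurableSet_Ioi e2, integral_exp_mul_complex_Iic r1,
    integral_exp_mul_complex_Ioi r2]
  have h1 : (a - Complex.I * ν : ℂ) ≠ 0 := fun h => by rw [h] at r1; simp at r1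
  have h2 : (-a - Complex.I * ν : ℂ) ≠ 0 := fun h => by rw [h] at r2; simp at r2
  have h3 : (a ^ 2 + ν ^ 2 : ℂ) ≠ 0 := by
    have : (a ^ 2 + ν ^ 2 : ℝ) ≠ 0 := by positivity
    exact_mod_cast this
  push_cast
  simp only [mul_zero, Complex.exp_zero]
  have h4 : (a ^ 2 + ν ^ 2 : ℂ) = -((a - Complex.I * ν) * (-a - Complex.I * ν)) := by
    linear_combination (ν^2 : ℂ) * Complex.I_sq
  rw [h4]
  field_simp
  ring

lemma hpt_series (t : ℝ) (ht : t ≠ 0) :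
    HasSum (fun k : ℕ => 4 / ((2 * k + 1) * Real.pi) * Real.exp (-((2 * k + 1) * Real.pi) * |t|))
      (hptDensity t) := by
  have hp := Real.pi_pos
  have hq : Real.exp (-(Real.pi * |t|)) < 1 := by
    rw [Real.exp_lt_one_iff]
    have := abs_pos.mpr ht
    have := mul_pos hp this
    linarith
  have hq0 := Real.exp_pos (-(Real.pi * |t|))
  have h := (Real.hasSum_log_sub_log_of_abs_lt_one (x := Real.exp (-(Real.pi * |t|)))
    (by rwa [abs_of_pos hq0])).mul_left (2 / Real.pi)
  convert! h using 1
  · ext k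
    rw [← Real.exp_nat_mul]
    rw [show ((2 * k + 1 : ℕ) : ℝ) * -(Real.pi * |t|) = -((2 * k + 1) * Real.pi) * |t| by
      push_cast; ring]
    field_simp
    norm_num
  · unfold hptDensity
    rw [← Real.log_div (by linarith) (by linarith)]
    congr 2
    rw [abs_div, abs_of_pos (Real.cosh_pos _), Real.abs_sinh, ← Real.cosh_abs]
    have : |Real.pi * t / 2| = Real.pi * |t| / 2 := by
      rw [abs_div, abs_mul, abs_of_pos hp]; norm_num
    rw [this, Real.cosh_eq, Real.sinh_eq]
    have e : Real.exp (-(Real.pi * |t|)) =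
      Real.exp (-(Real.pi * |t| / 2)) * Real.exp (-(Real.pi * |t| / 2)) := by
      rw [← Real.exp_add]; congr 1; ring
    have e2 : Real.exp (Real.pi * |t| / 2) * Real.exp (-(Real.pi * |t| / 2)) = 1 := by
      rw [← Real.exp_add]; simp
    have p1 := Real.exp_pos (-(Real.pi * |t| / 2))
    have p3 := Real.exp_pos (Real.pi * |t| / 2)
    rw [e] at hq
    rw [e]
    generalize Real.exp (-(Real.pi * |t| / 2)) = u at *
    generalize Real.exp (Real.pi * |t| / 2) = v at *
    have p2 : v - u ≠ 0 := by
      intro h'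
      have : v = u := by linarith
      subst this
      linarith
    have p4 : 1 - u * u ≠ 0 := by linarith
    rw [div_div_div_cancel_right₀ (by norm_num), div_eq_div_iff p2 p4]
    linear_combination (-2 * u) * e2

lemma hpt_sq_summable : Summable (fun k : ℕ => 8 / ((2 * k + 1) * Real.pi) ^ 2) := by
  have h := (hasSum_zeta_two.summable.comp_injective
    (i := fun k : ℕ => 2 * k + 1) (fun a b h => by simpa using h)).mul_left (8 / Real.pi ^ 2)
  refine h.congr fun k => ?_
  simp only [Function.comp]
  push_cast
  field_simp

lemma hpt_hasSum (ν : ℝ) :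
    HasSum (fun k : ℕ => ((8 / (((2 * k + 1) * Real.pi) ^ 2 + ν ^ 2) : ℝ) : ℂ))
      (∫ t : ℝ, (hptDensity t : ℂ) * Complex.exp (-(Complex.I * (ν : ℂ) * (t : ℂ)))) := by
  have hp := Real.pi_pos
  have ha : ∀ k : ℕ, 0 < (2 * k + 1) * Real.pi := fun k => by positivity
  have key := hasSum_integral_of_summable_integral_norm (μ := (volume : Measure ℝ))
    (F := fun (k : ℕ) (t : ℝ) => ((4 / ((2 * k + 1) * Real.pi) : ℝ) : ℂ) *
      ((Real.exp (-((2 * k + 1) * Real.pi) * |t|) : ℂ) * Complex.exp (-(Complex.I * ν * t))))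
    (fun k => (hpt_exp_int _ ν (ha k)).1.const_mul _) ?_
  · convert! key using 1
    · ext k
      rw [integral_const_mul, (hpt_exp_int _ ν (ha k)).2, ← Complex.ofReal_mul]
      congr 1
      have := ha k
      field_simp
      norm_num
    · refine integral_congr_ae ?_
      have : ∀ᵐ t : ℝ, t ≠ 0 := by simp [ae_iff]
      filter_upwards [this] with t ht
      have h := ((Complex.hasSum_ofReal.mpr (hpt_series t ht)).mul_right
        (Complex.exp (-(Complex.I * ν * t)))).tsum_eq
      rw [← h]
      congr 1
      ext k
      push_cast
      ring
  · refine hpt_sq_summable.congr fun k => ?_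
    have h0 := (hpt_exp_int _ 0 (ha k)).2
    have : ∀ t : ℝ, (Real.exp (-((2 * k + 1) * Real.pi) * |t|) : ℂ) *
        Complex.exp (-(Complex.I * (0:ℝ) * t)) =
        ((Real.exp (-((2 * k + 1) * Real.pi) * |t|) : ℝ) : ℂ) := fun t => by simp
    simp_rw [this] at h0
    rw [integral_complex_ofReal, Complex.ofReal_inj] at h0
    have hn : ∀ t : ℝ, ‖((4 / ((2 * k + 1) * Real.pi) : ℝ) : ℂ) *
      ((Real.exp (-((2 * k + 1) * Real.pi) * |t|) : ℂ) * Complex.exp (-(Complex.I * ν * t)))‖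
      = 4 / ((2 * k + 1) * Real.pi) * Real.exp (-((2 * k + 1) * Real.pi) * |t|) := fun t => by
      rw [norm_mul, norm_mul, Complex.norm_real, Complex.norm_real, Complex.norm_exp,
        Real.norm_of_nonneg (by positivity), Real.norm_of_nonneg (by positivity)]
      simp
    simp_rw [hn]
    rw [integral_const_mul, h0]
    have := ha k
    field_simp
    ring

lemma hpt_odd_part (f : ℕ → ℝ) (a b : ℝ) (h : HasSum f a)
    (he : HasSum (fun k => f (2 * k)) b) : HasSum (fun k => f (2 * k + 1)) (a - b) := by
  have ho : Summable (fun k => f (2 * k + 1)) :=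
    h.summable.comp_injective (i := fun k : ℕ => 2 * k + 1) (fun a b h => by simpa using h)
  have h1 := (he.even_add_odd ho.hasSum).unique h
  rw [← h1, add_sub_cancel_left]
  exact ho.hasSum

lemma hpt_odd_zero : HasSum (fun k : ℕ => 8 / (((2 * k + 1) * Real.pi) ^ 2 + 0 ^ 2)) (1 : ℝ) := by
  have hs := hpt_sq_summable
  have hz := hasSum_zeta_two
  have he : HasSum (fun k : ℕ => (1:ℝ) / ((2 * k : ℕ) : ℝ) ^ 2) (1 / 4 * (Real.pi ^ 2 / 6)) := by
    convert! hz.mul_left (1/4) using 1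
    ext k
    push_cast
    rw [mul_pow, div_mul_div_comm]; norm_num
  have h2 := (hpt_odd_part (fun n : ℕ => (1:ℝ) / (n : ℝ) ^ 2) _ _ hz he).mul_left (8 / Real.pi ^ 2)
  have hp := Real.pi_pos
  convert! h2 using 1
  · ext k
    push_cast
    field_simp
    ring
  · field_simp
    norm_num

lemma hpt_coth (y : ℝ) (hy : y ≠ 0) :
    HasSum (fun n : ℕ => 1 / ((n : ℝ) ^ 2 + y ^ 2))
      (Real.pi * (Real.cosh (Real.pi * y) / Real.sinh (Real.pi * y)) / (2 * y) + 1 / (2 * y ^ 2)) := by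
  have hx : (Complex.I * y : ℂ) ∈ Complex.integerComplement := by
    rintro ⟨n, hn⟩
    have := congrArg Complex.im hn
    simp at this
    exact hy this.symm
  have h0 : HasSum _ _ := (Summable.hasSum_iff (summable_cotTerm hx)).mpr (cot_series_rep' hx).symm
  have hyc : (y : ℂ) ≠ 0 := by exact_mod_cast hy
  rw [← Complex.hasSum_ofReal, ← hasSum_nat_add_iff' 1]
  have h1 := h0.mul_left (Complex.I / (2 * y))
  convert! h1 using 1
  · ext n
    rw [cotTerm_identity hx]
    have h3 : (((n : ℝ) + 1) ^ 2 + y ^ 2 : ℂ) ≠ 0 := by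
      have : (((n:ℝ)+1) ^ 2 + y ^ 2 : ℝ) ≠ 0 := by positivity
      exact_mod_cast this
    have h4 : (Complex.I * y + (n + 1)) * (Complex.I * y - (n + 1)) = -(((n : ℝ) + 1) ^ 2 + y ^ 2 : ℂ) := by
      push_cast
      linear_combination (y^2 : ℂ) * Complex.I_sq
    rw [h4]
    push_cast at h3 ⊢
    field_simp
    linear_combination Complex.I_sq
  · have hc : Complex.cot (Real.pi * (Complex.I * y)) =
      -Complex.I * (Complex.cosh (Real.pi * y) / Complex.sinh (Real.pi * y)) := by
      rw [Complex.cot, show (Real.pi * (Complex.I * y) : ℂ) = (Real.pi * y) * Complex.I by ring,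
        Complex.cos_mul_I, Complex.sin_mul_I, mul_comm, ← div_div, div_eq_mul_inv _ Complex.I,
        Complex.inv_I]
      ring
    rw [hc]
    simp
    field_simp
    ring_nf
    simp [Complex.I_sq]
    ring

lemma hpt_odd (ν : ℝ) (hν : ν ≠ 0) :
    HasSum (fun k : ℕ => 8 / (((2 * k + 1) * Real.pi) ^ 2 + ν ^ 2))
      (Real.tanh (ν / 2) / (ν / 2)) := by
  have hp := Real.pi_pos
  have hz := hpt_coth (ν / Real.pi) (by positivity)
  have hz2 := hpt_coth (ν / Real.pi / 2) (by positivity)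
  have he := hz2.mul_left (1/4)
  have hf : (fun k : ℕ => (1 / 4 : ℝ) * (1 / ((k : ℝ) ^ 2 + (ν / Real.pi / 2) ^ 2))) =
      (fun k : ℕ => (1:ℝ) / (((2 * k : ℕ) : ℝ) ^ 2 + (ν / Real.pi) ^ 2)) := by
    ext k
    push_cast
    rw [div_mul_div_comm]; congr 1 <;> ring
  rw [hf] at he
  have h2 := (hpt_odd_part (fun n : ℕ => (1:ℝ) / ((n : ℝ) ^ 2 + (ν / Real.pi) ^ 2)) _ _ hz he).mul_left
    (8 / Real.pi ^ 2)
  convert! h2 using 1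
  · ext k
    push_cast
    field_simp
  · have a1 : Real.pi * (ν / Real.pi) = 2 * (ν / 2) := by field_simp
    have a2 : Real.pi * (ν / Real.pi / 2) = ν / 2 := by field_simp
    rw [a1, a2, Real.cosh_two_mul, Real.sinh_two_mul, Real.tanh_eq_sinh_div_cosh]
    have s1 : Real.sinh (ν / 2) ≠ 0 := by
      rw [Ne, Real.sinh_eq_zero]; positivity
    have s2 := (Real.cosh_pos (ν / 2)).ne'
    field_simp
    ring

/-- Fourier transform of the high-peak-tent density:
`∫ p(t) e^{−iνt} dt = tanh(ν/2)/(ν/2)` for `ν ≠ 0`, and `∫ p(t) dt = 1`. -/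
theorem hptDensity_fourier (ν : ℝ) (hν : ν ≠ 0) :
    (∫ t : ℝ, (hptDensity t : ℂ) * Complex.exp (-(Complex.I * (ν : ℂ) * (t : ℂ)))) =
        ((Real.tanh (ν / 2) / (ν / 2) : ℝ) : ℂ) ∧
      (∫ t : ℝ, hptDensity t) = 1 := by
  refine ⟨(hpt_hasSum ν).unique (Complex.hasSum_ofReal.mpr (hpt_odd ν hν)), ?_⟩
  have h := (hpt_hasSum 0).unique (Complex.hasSum_ofReal.mpr hpt_odd_zero)
  simp only [Complex.ofReal_zero, mul_zero, zero_mul, neg_zero, Complex.exp_zero, mul_one] at h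
  rw [integral_complex_ofReal] at h
  exact_mod_cast h
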